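/- For every transposition t ∈ Equiv.Perm (Fin 6), the induced map on Segre collections S ↦ {t σ t⁻¹ : σ ∈ S} is an involution without fixed points: it moves every Segre collection, and applying it twice is the identity. (This is the key step showing that the action of S₆ on the six Segre collections realizes the outer automorphism of S₆: a transposition acts as a product of three disjoint transpositions on the six collections.) -/

import Mathlib

/-- A matching of `Fin 6`: a fixed-point-free involution. -/
def IsMatching (σ : Equiv.Perm (Fin 6)) : Prop :=
  (∀ x, σ (σ x) = x) ∧ ∀ x, σ x ≠ x

/-- Two matchings are disjoint if they share no pair. -/
def DisjointMatchings (σ τ : Equiv.Perm (Fin 6)) : Prop :=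
  ∀ x, σ x ≠ τ x

/-- A Segre collection: a set of five pairwise disjoint matchings of `Fin 6`. -/
def IsSegreCollection (S : Finset (Equiv.Perm (Fin 6))) : Prop :=
  S.card = 5 ∧ (∀ σ ∈ S, IsMatching σ) ∧
    ∀ σ ∈ S, ∀ τ ∈ S, σ ≠ τ → DisjointMatchings σ τ

/-- Conjugation by a transposition is a fixed-point-free involution on the set of
Segre collections. -/
theorem transposition_moves_every_segre_collection (t : Equiv.Perm (Fin 6))
    (ht : t.IsSwap) :
    ∀ S : Finset (Equiv.Perm (Fin 6)), IsSegreCollection S →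
      S.image (fun σ => t * σ * t⁻¹) ≠ S ∧
        (S.image (fun σ => t * σ * t⁻¹)).image (fun σ => t * σ * t⁻¹) = S := by
  obtain ⟨a, b, hab, rfl⟩ := ht
  rintro S ⟨hcard, hM, hD⟩
  constructor
  · intro hS
    -- some member of `S` does not pair `a` with `b`
    obtain ⟨σ, hσ, hσab⟩ : ∃ σ ∈ S, σ a ≠ b := by
      obtain ⟨σ, hσ, τ, hτ, hne⟩ := Finset.one_lt_card.mp (by omega : 1 < S.card)
      by_cases h : σ a = b
      · exact ⟨τ, hτ, fun h' => hD σ hσ τ hτ hne a (h.trans h'.symm)⟩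
      · exact ⟨σ, hσ, h⟩
    obtain ⟨hinv, hfix⟩ := hM σ hσ
    -- a point outside the two pairs through `a` and `b`
    obtain ⟨d, hd⟩ : ∃ d, d ∉ ({a, b, σ a, σ b} : Finset (Fin 6)) := by
      by_contra! h
      have h1 := Finset.card_le_card (fun x _ => h x : Finset.univ ⊆ _)
      have h2 : ({a, b, σ a, σ b} : Finset (Fin 6)).card ≤ 4 := Finset.card_le_four
      simp only [Finset.card_univ, Fintype.card_fin] at h1
      omega
    simp only [Finset.mem_insert, Finset.mem_singleton, not_or] at hd
    obtain ⟨hda, hdb, hdσa, hdσb⟩ := hd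
    have hσda : σ d ≠ a := fun h => hdσa (by rw [← h, hinv])
    have hσdb : σ d ≠ b := fun h => hdσb (by rw [← h, hinv])
    have hσba : σ b ≠ a := fun h => hσab (by rw [← h, hinv])
    have hmem : Equiv.swap a b * σ * (Equiv.swap a b)⁻¹ ∈ S := by
      have := Finset.mem_image_of_mem (fun σ => Equiv.swap a b * σ * (Equiv.swap a b)⁻¹) hσ
      rwa [hS] at this
    -- `σ` and its conjugate share the pair `{d, σ d}`, hence are equal
    have heq : Equiv.swap a b * σ * (Equiv.swap a b)⁻¹ = σ := by
      by_contra hne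
      refine hD _ hmem σ hσ hne d ?_
      simp only [Equiv.swap_inv, Equiv.Perm.mul_apply]
      rw [Equiv.swap_apply_of_ne_of_ne hda hdb, Equiv.swap_apply_of_ne_of_ne hσda hσdb]
    have h := congrArg (fun p : Equiv.Perm (Fin 6) => p a) heq
    simp only [Equiv.swap_inv, Equiv.Perm.mul_apply, Equiv.swap_apply_left] at h
    rw [Equiv.swap_apply_of_ne_of_ne hσba (hfix b)] at h
    exact hab (σ.injective h).symm
  · rw [Finset.image_image]
    have hid : ((fun σ => Equiv.swap a b * σ * (Equiv.swap a b)⁻¹) ∘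
        fun σ => Equiv.swap a b * σ * (Equiv.swap a b)⁻¹) = (id : Equiv.Perm (Fin 6) → _) := by
      funext σ
      ext x
      simp [Equiv.Perm.mul_apply]
    rw [hid, Finset.image_id]
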